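/- For every real α > 1, the MAX-game on the path graph with 3⌊α⌋ + 4 vertices, with initial profile consisting of one endpoint of the path as the only gateway, admits an infinite sequence of profiles S_0, S_1, S_2, … in which each S_{i+1} arises from S_i by an improving response; hence the MAX-game is not a finite improvement property game. -/

import Mathlib

open Finset

/-- Distance from a node `u` to the gateway set `S` (hop distance to nearest gateway). -/
noncomputable def gwDist {V : Type*} (G : SimpleGraph V) (S : Finset V) (u : V) : ℕ :=
  sInf ((fun s => G.dist u s) '' (S : Set V))

/-- Communication distance `δ_S(u,v) = min{d(u,v), d(u,S) + d(S,v)}`. -/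
noncomputable def comDist {V : Type*} (G : SimpleGraph V) (S : Finset V) (u v : V) : ℕ :=
  min (G.dist u v) (gwDist G S u + gwDist G S v)

/-- Private cost of node `v` in the MAX-game. -/
noncomputable def maxCost {V : Type*} [Fintype V] [DecidableEq V]
    (G : SimpleGraph V) (α : ℝ) (S : Finset V) (v : V) : ℝ :=
  (if v ∈ S then α else 0) + ((Finset.univ.sup (fun u => comDist G S v u) : ℕ) : ℝ)

/-- Social cost of the MAX-game. -/
noncomputable def maxSocial {V : Type*} [Fintype V] [DecidableEq V]
    (G : SimpleGraph V) (α : ℝ) (S : Finset V) : ℝ :=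
  ∑ v : V, maxCost G α S v

/-- `v` performs an improving response changing profile `S` into `S'` in the MAX-game. -/
def MaxIRBy {V : Type*} [Fintype V] [DecidableEq V]
    (G : SimpleGraph V) (α : ℝ) (v : V) (S S' : Finset V) : Prop :=
  ((v ∉ S ∧ S' = insert v S) ∨ (v ∈ S ∧ S' = S.erase v ∧ (S.erase v).Nonempty)) ∧
    maxCost G α S' v < maxCost G α S v

/-- `S'` arises from `S` by an improving response in the MAX-game. -/
def MaxIR {V : Type*} [Fintype V] [DecidableEq V]
    (G : SimpleGraph V) (α : ℝ) (S S' : Finset V) : Prop :=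
  ∃ v, MaxIRBy G α v S S'

/-- `S` is a Nash equilibrium of the MAX-game: no node has an improving response. -/
def MaxNash {V : Type*} [Fintype V] [DecidableEq V]
    (G : SimpleGraph V) (α : ℝ) (S : Finset V) : Prop :=
  ∀ S', ¬ MaxIR G α S S'

theorem SimpleGraph.dist_pathGraph {n : ℕ} (i j : Fin n) :
    (SimpleGraph.pathGraph n).dist i j = Nat.dist i j := by
  obtain ⟨n, rfl⟩ : ∃ k, n = k + 1 := ⟨n - 1, by have := i.isLt; omega⟩
  have upper : ∀ (k : ℕ) (a b : Fin (n + 1)), (a : ℕ) + k = b →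
      (SimpleGraph.pathGraph (n + 1)).dist a b ≤ k := by
    intro k
    induction k with
    | zero =>
      intro a b h
      obtain rfl : a = b := Fin.ext h
      simp
    | succ k ih =>
      intro a b h
      have hc : (a : ℕ) + k < n + 1 := by have := b.isLt; omega
      have hadj : (SimpleGraph.pathGraph (n + 1)).Adj ⟨a + k, hc⟩ b := by
        rw [SimpleGraph.pathGraph_adj]
        left
        simpa [add_assoc] using h
      have h₁ := ih a ⟨a + k, hc⟩ rfl
      have h₂ := (SimpleGraph.pathGraph_connected n).dist_triangle
        (u := a) (v := ⟨a + k, hc⟩) (w := b)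
      rw [SimpleGraph.dist_eq_one_iff_adj.mpr hadj] at h₂
      omega
  have lower : ∀ {a b : Fin (n + 1)} (w : (SimpleGraph.pathGraph (n + 1)).Walk a b),
      Nat.dist a b ≤ w.length := by
    intro a b w
    induction w with
    | nil => simp
    | cons h w ih =>
      rw [SimpleGraph.pathGraph_adj] at h
      simp only [Nat.dist, SimpleGraph.Walk.length_cons] at ih ⊢
      omega
  apply le_antisymm
  · rcases le_total (i : ℕ) j with h | h
    · rw [Nat.dist_eq_sub_of_le h]
      exact upper _ i j (by omega)
    · rw [SimpleGraph.dist_comm, Nat.dist_eq_sub_of_le_right h]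
      exact upper _ j i (by omega)
  · obtain ⟨w, hw⟩ := ((SimpleGraph.pathGraph_connected n).preconnected i j).exists_walk_length_eq_dist
    exact hw ▸ lower w

section GatewayBounds

variable {V : Type*} (G : SimpleGraph V) {S : Finset V}

theorem gwDist_le_dist {s : V} (hs : s ∈ S) (u : V) : gwDist G S u ≤ G.dist u s :=
  Nat.sInf_le ⟨s, hs, rfl⟩

theorem exists_mem_dist_eq_gwDist (hS : S.Nonempty) (u : V) :
    ∃ s ∈ S, G.dist u s = gwDist G S u := by
  obtain ⟨s, hs⟩ := hS
  exact Nat.sInf_mem (s := (fun s => G.dist u s) '' (S : Set V)) ⟨_, s, hs, rfl⟩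

theorem comDist_le_dist (u v : V) : comDist G S u v ≤ G.dist u v :=
  min_le_left _ _

theorem comDist_le_dist_add_dist {s t : V} (hs : s ∈ S) (ht : t ∈ S) (u v : V) :
    comDist G S u v ≤ G.dist u s + G.dist v t :=
  (min_le_right _ _).trans (add_le_add (gwDist_le_dist G hs u) (gwDist_le_dist G ht v))

theorem le_comDist (hS : S.Nonempty) {u v : V} {c : ℕ} (h : c ≤ G.dist u v)
    (h' : ∀ s ∈ S, ∀ t ∈ S, c ≤ G.dist u s + G.dist v t) : c ≤ comDist G S u v := by
  obtain ⟨s, hs, hsu⟩ := exists_mem_dist_eq_gwDist G hS u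
  obtain ⟨t, ht, htv⟩ := exists_mem_dist_eq_gwDist G hS v
  refine le_min h ?_
  rw [← hsu, ← htv]
  exact h' s hs t ht

variable [Fintype V] [DecidableEq V]

theorem MaxIR.of_open {α : ℝ} {v : V} (hv : v ∉ S) (u : V) {a b : ℕ}
    (hb : b ≤ comDist G S v u) (ha : ∀ w, comDist G (insert v S) v w ≤ a)
    (hab : α + a < b) : MaxIR G α S (insert v S) := by
  refine ⟨v, Or.inl ⟨hv, rfl⟩, ?_⟩
  have h₁ : b ≤ Finset.univ.sup (fun u => comDist G S v u) :=
    hb.trans (Finset.le_sup (f := fun u => comDist G S v u) (Finset.mem_univ u))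
  have h₂ : Finset.univ.sup (fun u => comDist G (insert v S) v u) ≤ a :=
    Finset.sup_le fun w _ => ha w
  simp only [maxCost, Finset.mem_insert_self, hv, if_true, if_false]
  have h₁' : (b : ℝ) ≤ _ := Nat.cast_le.mpr h₁
  have h₂' : _ ≤ (a : ℝ) := Nat.cast_le.mpr h₂
  linarith

theorem MaxIR.of_close {α : ℝ} {v : V} (hv : v ∉ S) (hS : S.Nonempty) (u : V) {a b : ℕ}
    (hb : b ≤ comDist G (insert v S) v u) (ha : ∀ w, comDist G S v w ≤ a)
    (hab : (a : ℝ) < α + b) : MaxIR G α (insert v S) S := by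
  have he : (insert v S).erase v = S := Finset.erase_insert hv
  refine ⟨v, Or.inr ⟨Finset.mem_insert_self v S, he.symm, he.symm ▸ hS⟩, ?_⟩
  have h₁ : b ≤ Finset.univ.sup (fun u => comDist G (insert v S) v u) :=
    hb.trans (Finset.le_sup (f := fun u => comDist G (insert v S) v u) (Finset.mem_univ u))
  have h₂ : Finset.univ.sup (fun u => comDist G S v u) ≤ a :=
    Finset.sup_le fun w _ => ha w
  simp only [maxCost, Finset.mem_insert_self, hv, if_true, if_false]
  have h₁' : (b : ℝ) ≤ _ := Nat.cast_le.mpr h₁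
  have h₂' : _ ≤ (a : ℝ) := Nat.cast_le.mpr h₂
  linarith

end GatewayBounds

theorem exists_seq_of_four_cycle {β : Type*} {r : β → β → Prop} {a b c d : β}
    (hab : r a b) (hbc : r b c) (hcd : r c d) (hda : r d a) :
    ∃ seq : ℕ → β, seq 0 = a ∧ ∀ i, r (seq i) (seq (i + 1)) := by
  refine ⟨fun i => if i % 4 = 0 then a else if i % 4 = 1 then b else if i % 4 = 2 then c else d,
    by simp, fun i => ?_⟩
  have h : i % 4 = 0 ∨ i % 4 = 1 ∨ i % 4 = 2 ∨ i % 4 = 3 := by omega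
  rcases h with h | h | h | h <;> simp [Nat.add_mod, h, hab, hbc, hcd, hda]

/-- For α > 1, the MAX-game on the path with 3⌊α⌋ + 4 vertices, starting from the profile
in which one endpoint is the only gateway, has an infinite improving-response sequence:
the MAX-game is not a FIPG. -/
theorem stmt_17 (α : ℝ) (hα : 1 < α) :
    ∃ seq : ℕ → Finset (Fin (3 * Nat.floor α + 4)),
      seq 0 = {(0 : Fin (3 * Nat.floor α + 4))} ∧
      ∀ i, MaxIR (SimpleGraph.pathGraph (3 * Nat.floor α + 4)) α
        (seq i) (seq (i + 1)) := by
  have hk : 1 ≤ ⌊α⌋₊ := Nat.le_floor (by simpa using hα.le)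
  have hle : (⌊α⌋₊ : ℝ) ≤ α := Nat.floor_le (by linarith)
  have hlt : α < ⌊α⌋₊ + 1 := Nat.lt_floor_add_one α
  have hhalf : (((⌊α⌋₊ + 1) / 2 : ℕ) : ℝ) < α := by
    rcases hk.eq_or_lt with h | h
    · rw [← h]
      simpa using hα
    · exact lt_of_lt_of_le (Nat.cast_lt.mpr (by omega)) hle
  generalize ⌊α⌋₊ = k at *
  obtain ⟨x, hx⟩ : ∃ x : Fin (3 * k + 4), (x : ℕ) = k + 1 := ⟨⟨k + 1, by omega⟩, rfl⟩
  obtain ⟨y, hy⟩ : ∃ y : Fin (3 * k + 4), (y : ℕ) = 2 * k + 2 := ⟨⟨2 * k + 2, by omega⟩, rfl⟩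
  obtain ⟨z, hz⟩ : ∃ z : Fin (3 * k + 4), (z : ℕ) = 3 * k + 3 := ⟨⟨3 * k + 3, by omega⟩, rfl⟩
  have h0 : ((0 : Fin (3 * k + 4)) : ℕ) = 0 := rfl
  have hx0 : x ≠ 0 := fun h => by rw [h] at hx; omega
  have hy0 : y ≠ 0 := fun h => by rw [h] at hy; omega
  have hxy : x ≠ y := fun h => by rw [h] at hx; omega
  refine exists_seq_of_four_cycle (b := {y, 0}) (c := {y, x, 0}) (d := {x, 0}) ?_ ?_ ?_ ?_
  · refine MaxIR.of_open _ (by simpa using hy0) 0 (a := k + 1) (b := 2 * k + 2)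
      (le_comDist _ (by simp) ?_ ?_) (fun w => ?_) (by push_cast; linarith)
    · rw [SimpleGraph.dist_pathGraph, Nat.dist]; omega
    · simp only [Finset.mem_singleton, forall_eq, SimpleGraph.dist_pathGraph, Nat.dist]
      omega
    · have h₁ := comDist_le_dist_add_dist (SimpleGraph.pathGraph (3 * k + 4)) (S := {y, 0})
        (s := y) (t := 0) (by simp) (by simp) y w
      have h₂ := comDist_le_dist (SimpleGraph.pathGraph (3 * k + 4)) (S := {y, 0}) y w
      simp only [SimpleGraph.dist_pathGraph, Nat.dist] at h₁ h₂
      omega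
  · rw [Finset.insert_comm y x]
    refine MaxIR.of_open _ (by simp [hx0, hxy]) z (a := k + 1) (b := 2 * k + 2)
      (le_comDist _ (by simp) ?_ ?_) (fun w => ?_) (by push_cast; linarith)
    · rw [SimpleGraph.dist_pathGraph, Nat.dist]; omega
    · simp only [Finset.mem_insert, Finset.mem_singleton, forall_eq_or_imp, forall_eq,
        SimpleGraph.dist_pathGraph, Nat.dist]
      omega
    · have h₁ := comDist_le_dist_add_dist (SimpleGraph.pathGraph (3 * k + 4)) (S := {x, y, 0})
        (s := x) (t := y) (by simp) (by simp) x w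
      have h₂ := comDist_le_dist (SimpleGraph.pathGraph (3 * k + 4)) (S := {x, y, 0}) x w
      simp only [SimpleGraph.dist_pathGraph, Nat.dist] at h₁ h₂
      omega
  · refine MaxIR.of_close _ (by simp [hy0, hxy.symm]) (by simp) z (a := k + 1 + (k + 1) / 2)
      (b := k + 1) (le_comDist _ (by simp) ?_ ?_) (fun w => ?_) (by push_cast at hhalf ⊢; linarith)
    · rw [SimpleGraph.dist_pathGraph, Nat.dist]; omega
    · simp only [Finset.mem_insert, Finset.mem_singleton, forall_eq_or_imp, forall_eq,
        SimpleGraph.dist_pathGraph, Nat.dist]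
      omega
    · have h₁ := comDist_le_dist_add_dist (SimpleGraph.pathGraph (3 * k + 4)) (S := {x, 0})
        (s := x) (t := x) (by simp) (by simp) y w
      have h₂ := comDist_le_dist_add_dist (SimpleGraph.pathGraph (3 * k + 4)) (S := {x, 0})
        (s := x) (t := 0) (by simp) (by simp) y w
      have h₃ := comDist_le_dist (SimpleGraph.pathGraph (3 * k + 4)) (S := {x, 0}) y w
      simp only [SimpleGraph.dist_pathGraph, Nat.dist] at h₁ h₂ h₃
      omega
  · refine MaxIR.of_close _ (by simpa using hx0) (by simp) z (a := 2 * k + 2) (b := 2 * k + 2)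
      (le_comDist _ (by simp) ?_ ?_) (fun w => ?_) (by linarith)
    · rw [SimpleGraph.dist_pathGraph, Nat.dist]; omega
    · simp only [Finset.mem_insert, Finset.mem_singleton, forall_eq_or_imp, forall_eq,
        SimpleGraph.dist_pathGraph, Nat.dist]
      omega
    · refine (comDist_le_dist _ x w).trans ?_
      rw [SimpleGraph.dist_pathGraph, Nat.dist]
      omega
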